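/- Let i be a nonnegative integer and let α, β be complex numbers. Assume that (β)_{m+n}, (α/2)_n and (1+(α+β)/2)_n are nonzero for all nonnegative integers m, n, that no argument of Γ appearing on the right-hand side below is a nonpositive integer, and that the double series defining the Kampé de Fériet function converges absolutely. Then F^{1:1;3}_{1:0;2}[α : 3β/2−α/2−1−i ; (α−β)/2+1+i, 1+α/2, (α−β)/2 ; β : — ; α/2, 1+(α+β)/2 ; 1/2, 1/2] = (2^{α−1} · Γ(β/2−α/2−i) · Γ(1+(α+β)/2)) / (Γ(β/2−α/2) · Γ(1+α)) · Σ_{r=0}^{i} (−1)^r · C(i,r) · Γ((α+r+1)/2) / Γ((β+r+1)/2−i). -/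

import Mathlib

open Complex

noncomputable section

/-- Pochhammer symbol `(a)_n = a (a+1) ⋯ (a+n-1)`. -/
def poch (a : ℂ) (n : ℕ) : ℂ := ∏ k ∈ Finset.range n, (a + k)

/-- `z` is not a nonpositive integer. -/
def notNonposInt (z : ℂ) : Prop := ∀ n : ℕ, z ≠ -(n : ℂ)

/-- Term of the Kampé de Fériet double series `F^{1:1;3}_{1:0;2}`. -/
def kdfTerm (α ε b₁ b₂ b₃ β d₁ d₂ x y : ℂ) (p : ℕ × ℕ) : ℂ :=
  poch α (p.1 + p.2) * poch ε p.1 * poch b₁ p.2 * poch b₂ p.2 * poch b₃ p.2 /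
    (poch β (p.1 + p.2) * poch d₁ p.2 * poch d₂ p.2) * x ^ p.1 * y ^ p.2 /
    ((p.1.factorial : ℂ) * (p.2.factorial : ℂ))

theorem poch_zero (a : ℂ) : poch a 0 = 1 := by simp [poch]

theorem poch_succ (a : ℂ) (n : ℕ) : poch a (n + 1) = poch a n * (a + n) :=
  Finset.prod_range_succ _ _

theorem poch_succ_left (a : ℂ) (n : ℕ) : poch a (n + 1) = a * poch (a + 1) n := by
  rw [poch, Finset.prod_range_succ', mul_comm, poch]
  congr 1
  · simp
  · refine Finset.prod_congr rfl fun k _ => ?_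
    push_cast
    ring

theorem poch_add (a : ℂ) (m n : ℕ) : poch a (m + n) = poch a m * poch (a + m) n := by
  induction n with
  | zero => simp [poch_zero]
  | succ n ih =>
    rw [← add_assoc, poch_succ, ih, poch_succ]
    push_cast
    ring

theorem poch_mul_add (a : ℂ) (n : ℕ) : poch a n * (a + n) = a * poch (a + 1) n := by
  rw [← poch_succ, poch_succ_left]

theorem poch_ne_zero {a : ℂ} (ha : notNonposInt a) (n : ℕ) : poch a n ≠ 0 :=
  Finset.prod_ne_zero_iff.mpr fun k _ h => ha k (eq_neg_of_add_eq_zero_left h)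

theorem Gamma_add_natCast {z : ℂ} (hz : notNonposInt z) (n : ℕ) :
    Gamma (z + n) = poch z n * Gamma z := by
  induction n with
  | zero => simp [poch_zero]
  | succ n ih =>
    have h : z + n ≠ 0 := fun h => hz n (eq_neg_of_add_eq_zero_left h)
    rw [poch_succ, Nat.cast_add_one, ← add_assoc, Gamma_add_one _ h, ih]
    ring

theorem notNonposInt.add_natCast {z : ℂ} (hz : notNonposInt z) (n : ℕ) :
    notNonposInt (z + n) := fun k h => hz (k + n) <| by
  push_cast
  linear_combination h

theorem inv_Gamma_eq (s : ℂ) : (Gamma s)⁻¹ = s * (Gamma (s + 1))⁻¹ :=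
  one_div_Gamma_eq_self_mul_one_div_Gamma_add_one s

/-- The partial-sum form of the telescoping behind the Pfaff–Saalschütz identity. -/
theorem saalschutz_partial (A B C : ℂ) (k m : ℕ) :
    ∑ n ∈ Finset.range (k + 1),
      (((k + m + 1).choose n : ℂ) * poch A n * poch B n * poch (C + n) (k + m + 1 - n) *
          poch (C - A - B) (k + m + 1 - n) -
        (C - A + (k + m : ℕ)) * (C - B + (k + m : ℕ)) *
        (((k + m).choose n : ℂ) * poch A n * poch B n * poch (C + n) (k + m - n) *
          poch (C - A - B) (k + m - n))) =
      -(((k + m).choose k : ℂ) * poch A (k + 1) * poch B (k + 1) * poch (C + k) m *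
          poch (C - A - B) m) := by
  induction k generalizing m with
  | zero =>
    simp only [zero_add, Finset.sum_range_one, Nat.choose_zero_right, poch_zero, Nat.sub_zero,
      poch_succ, Nat.cast_zero, Nat.cast_one, add_zero]
    ring
  | succ k ih =>
    rw [Finset.sum_range_succ]
    have e : k + 1 + m = k + (m + 1) := by ring
    rw [e, ih (m + 1)]
    have e1 : k + (m + 1) + 1 - (k + 1) = m + 1 := by omega
    have e2 : k + (m + 1) - (k + 1) = m := by omega
    rw [e1, e2]
    have hc : (((k + (m + 1)).choose (k + 1) : ℕ) : ℂ) * (k + 1) =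
        ((k + (m + 1)).choose k : ℂ) * (m + 1) := by
      have := Nat.choose_succ_right_eq (k + (m + 1)) k
      rw [show k + (m + 1) - k = m + 1 by omega] at this
      exact_mod_cast this
    rw [Nat.choose_succ_succ, poch_succ A (k + 1), poch_succ B (k + 1), poch_succ_left (C + k) m,
      poch_succ (C - A - B) m, poch_succ (C + (k + 1 : ℕ)) m]
    rw [show C + (k + 1 : ℕ) = C + k + 1 by push_cast; ring]
    push_cast
    linear_combination (poch A (k + 1) * poch B (k + 1) * poch (C + k + 1) m *
      poch (C - A - B) m * (C - A - B + m)) * (-hc)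

/-- The **Pfaff–Saalschütz identity** in polynomial form. -/
theorem saalschutz (A B C : ℂ) (N : ℕ) :
    ∑ n ∈ Finset.range (N + 1), (N.choose n : ℂ) * poch A n * poch B n * poch (C + n) (N - n) *
      poch (C - A - B) (N - n) = poch (C - A) N * poch (C - B) N := by
  induction N with
  | zero => simp [poch_zero]
  | succ N ih =>
    have h := saalschutz_partial A B C N 0
    rw [Finset.sum_sub_distrib, ← Finset.mul_sum] at h
    simp only [add_zero, ih, poch_zero, Nat.choose_self] at h
    rw [Finset.sum_range_succ, Nat.sub_self, Nat.choose_self, poch_zero, poch_zero, poch_succ (C - A),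
      poch_succ (C - B)]
    push_cast at h ⊢
    linear_combination h

/-- The coefficient identity behind the reduction of the double series. -/
theorem sum_kdf_coeff (β γ q : ℂ) (N : ℕ) :
    ∑ n ∈ Finset.range (N + 1), (N.choose n : ℂ) * poch (γ - q) n * poch (γ - 1 - β) n *
      (2 * (γ - 1 - β / 2 + n)) * poch (γ + n) (N - n) * poch (β - (γ - q)) (N - n) =
    poch β N * ((γ - 1 - β) * poch q N + (γ - 1 + N) * poch (q - 1) N) := by
  have h1 := saalschutz (γ - q) (γ - β) γ N
  have h2 := saalschutz (γ - q) (γ - 1 - β) (γ - 1) N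
  have e1 : γ - (γ - q) - (γ - β) = β - (γ - q) := by ring
  have e2 : γ - 1 - (γ - q) - (γ - 1 - β) = β - (γ - q) := by ring
  rw [e1, sub_sub_cancel, sub_sub_cancel] at h1
  rw [e2, sub_sub_cancel, show γ - 1 - (γ - q) = q - 1 by ring] at h2
  have h : poch β N * ((γ - 1 - β) * poch q N + (γ - 1 + N) * poch (q - 1) N) =
      (γ - 1 - β) * (poch q N * poch β N) + (γ - 1 + N) * (poch (q - 1) N * poch β N) := by ring
  rw [h, ← h1, ← h2, Finset.mul_sum, Finset.mul_sum, ← Finset.sum_add_distrib]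
  refine Finset.sum_congr rfl fun n hn => ?_
  obtain ⟨m, rfl⟩ := Nat.exists_eq_add_of_le (Finset.mem_range_succ_iff.mp hn)
  rw [Nat.add_sub_cancel_left]
  have h3 := poch_mul_add (γ - 1 - β) n
  rw [show γ - 1 - β + 1 = γ - β by ring] at h3
  have h4 := poch_mul_add (γ - 1 + n) m
  rw [show γ - 1 + n + 1 = γ + n by ring] at h4
  push_cast
  linear_combination (-((n + m).choose n : ℂ) * poch (γ - q) n * poch (γ + n) m *
    poch (β - (γ - q)) m) * (-h3) - ((n + m).choose n : ℂ) * poch (γ - q) n *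
    poch (γ - 1 - β) n * poch (β - (γ - q)) m * h4

/-- The `n`-th term of the regularized Gauss series `₂F₁(a, b; c; 1/2) / Γ(c)`. -/
def gaussTerm (a b c : ℂ) (n : ℕ) : ℂ :=
  poch a n * poch b n * (Gamma (c + n))⁻¹ / n.factorial / 2 ^ n

theorem gaussTerm_swap (a b c : ℂ) (n : ℕ) : gaussTerm a b c n = gaussTerm b a c n := by
  rw [gaussTerm, gaussTerm, mul_comm (poch a n)]

theorem tendsto_add_natCast_div (a b : ℂ) :
    Filter.Tendsto (fun n : ℕ => (a + n) / (b + n)) Filter.atTop (nhds 1) := by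
  have h (z : ℂ) : Filter.Tendsto (fun n : ℕ => z / n + 1) Filter.atTop (nhds 1) := by
    simpa using (tendsto_const_div_atTop_nhds_zero_nat z).add_const 1
  have h' := (h a).div (h b) one_ne_zero
  rw [div_one] at h'
  refine h'.congr' ?_
  filter_upwards [Filter.eventually_ne_atTop 0] with n hn
  have hn' : (n : ℂ) ≠ 0 := Nat.cast_ne_zero.mpr hn
  simp only [Pi.div_apply]
  rw [← mul_div_mul_right _ _ hn', add_mul, add_mul, div_mul_cancel₀ _ hn', div_mul_cancel₀ _ hn',
    one_mul]

theorem exists_natCast_add_ne_zero (z : ℂ) : ∃ M : ℕ, ∀ n ≥ M, notNonposInt (z + n) := by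
  obtain ⟨M, hM⟩ := exists_nat_gt ‖z‖
  refine ⟨M, fun n hn k h => ?_⟩
  have h1 : z = -((n + k : ℕ) : ℂ) := by push_cast; linear_combination h
  have h2 : ‖z‖ = (n + k : ℕ) := by rw [h1, norm_neg, norm_natCast]
  rw [h2] at hM
  have : n + k < M := by exact_mod_cast hM
  omega

theorem eventually_notNonposInt (z : ℂ) : ∀ᶠ n : ℕ in Filter.atTop, notNonposInt (z + n) :=
  Filter.eventually_atTop.mpr (exists_natCast_add_ne_zero z)

theorem summable_gaussTerm (a b c : ℂ) : Summable (gaussTerm a b c) := by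
  refine summable_of_ratio_norm_eventually_le (r := 3 / 4) (by norm_num) ?_
  have h := ((tendsto_add_natCast_div a c).mul (tendsto_add_natCast_div b 1)).norm
  rw [mul_one, norm_one] at h
  filter_upwards [h.eventually_le_const (show (1 : ℝ) < 3 / 2 by norm_num),
    eventually_notNonposInt c] with n hn hc
  have hc0 : c + n ≠ 0 := fun h => hc 0 (by simpa using h)
  have hn0 : (1 : ℂ) + n ≠ 0 := by rw [add_comm]; exact Nat.cast_add_one_ne_zero n
  have hf : (n.factorial : ℂ) ≠ 0 := Nat.cast_ne_zero.mpr n.factorial_ne_zero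
  have e : gaussTerm a b c (n + 1) =
      ((a + n) / (c + n) * ((b + n) / (1 + n))) * (1 / 2) * gaussTerm a b c n := by
    rw [gaussTerm, gaussTerm, inv_Gamma_eq (c + n), poch_succ, poch_succ, Nat.factorial_succ,
      Nat.cast_add_one n, ← add_assoc]
    push_cast
    rw [add_comm (n : ℂ) 1, pow_succ]
    field_simp
  rw [e, norm_mul, norm_mul]
  gcongr
  calc _ ≤ (3 / 2 : ℝ) * ‖(1 / 2 : ℂ)‖ := by gcongr
    _ = 3 / 4 := by norm_num

theorem tsum_eq_of_telescope {f g h : ℕ → ℂ} (hf : Summable f) (hg : Summable g)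
    (hh : Summable h) (h0 : f 0 = g 0 - h 0) (hs : ∀ n, f (n + 1) = g (n + 1) - h (n + 1) + h n) :
    ∑' n, f n = ∑' n, g n := by
  rw [hf.tsum_eq_zero_add, hg.tsum_eq_zero_add]
  have hg' := (summable_nat_add_iff 1).mpr hg
  have hh' := (summable_nat_add_iff 1).mpr hh
  simp_rw [hs]
  rw [(hg'.sub hh').tsum_add hh, hg'.tsum_sub hh', h0, hh.tsum_eq_zero_add]
  ring

/-- The value at `1/2` of the regularized Gauss hypergeometric function. -/
def gaussHalf (a b c : ℂ) : ℂ := ∑' n, gaussTerm a b c n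

theorem gaussHalf_swap (a b c : ℂ) : gaussHalf a b c = gaussHalf b a c :=
  tsum_congr (gaussTerm_swap a b c)

theorem gaussHalf_contiguous (a b c : ℂ) :
    (c - 1 - a) * gaussHalf a b c =
      gaussHalf a (b - 1) (c - 1) - a / 2 * gaussHalf (a + 1) b c := by
  have hs := summable_gaussTerm
  have h : ∑' n, ((c - 1 - a) * gaussTerm a b c n + a / 2 * gaussTerm (a + 1) b c n) =
      ∑' n, gaussTerm a (b - 1) (c - 1) n := by
    refine tsum_eq_of_telescope (h := fun n => a / 2 * gaussTerm (a + 1) b c n)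
      (((hs a b c).mul_left _).add ((hs _ _ _).mul_left _)) (hs _ _ _) ((hs _ _ _).mul_left _) ?_ ?_
    · have := inv_Gamma_eq (c - 1)
      rw [sub_add_cancel] at this
      simp only [gaussTerm, poch_zero, Nat.cast_zero, add_zero, this]
      simp
      ring
    · intro n
      have hn0 : (n : ℂ) + 1 ≠ 0 := Nat.cast_add_one_ne_zero n
      have hf : (n.factorial : ℂ) ≠ 0 := Nat.cast_ne_zero.mpr n.factorial_ne_zero
      have e3 := poch_succ_left (b - 1) n
      rw [sub_add_cancel] at e3
      simp only [gaussTerm]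
      rw [show c - 1 + ((n + 1 : ℕ) : ℂ) = c + n by push_cast; ring, inv_Gamma_eq (c + n), e3,
        show c + ((n + 1 : ℕ) : ℂ) = c + n + 1 by push_cast; ring, Nat.factorial_succ, pow_succ,
        poch_succ_left a, poch_succ b, poch_succ (a + 1)]
      generalize (Gamma (c + n + 1))⁻¹ = G
      push_cast
      field_simp
      ring
  rw [((hs a b c).mul_left _).tsum_add ((hs _ _ _).mul_left _), tsum_mul_left, tsum_mul_left] at h
  rw [gaussHalf, gaussHalf, gaussHalf]
  linear_combination h

theorem gaussHalf_add_two (a b : ℂ) :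
    (a + 1) / 2 * gaussHalf (a + 2) b ((a + b + 1) / 2 + 1) =
      gaussHalf a b ((a + b + 1) / 2) := by
  have hs := summable_gaussTerm
  rw [gaussHalf, gaussHalf, ← tsum_mul_left]
  set c := (a + b + 1) / 2 with hc
  refine tsum_eq_of_telescope (h := fun n => b / 2 * gaussTerm (a + 1) (b + 1) (c + 1) n)
    ((hs _ _ _).mul_left _) (hs _ _ _) ((hs _ _ _).mul_left _) ?_ ?_
  · have := inv_Gamma_eq c
    simp only [gaussTerm, poch_zero, Nat.cast_zero, add_zero, this]
    simp
    rw [hc]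
    ring
  · intro n
    have hn0 : (n : ℂ) + 1 ≠ 0 := Nat.cast_add_one_ne_zero n
    have hf : (n.factorial : ℂ) ≠ 0 := Nat.cast_ne_zero.mpr n.factorial_ne_zero
    have e : (a + 1) / 2 * poch (a + 2) (n + 1) =
        poch (a + 1) n * (a + 1 + n) * (a + 2 + n) / 2 := by
      have h1 := poch_succ_left (a + 1) (n + 1)
      rw [poch_succ, poch_succ, show a + 1 + 1 = a + 2 by ring] at h1
      push_cast at h1
      linear_combination -h1 / 2
    simp only [gaussTerm]
    rw [mul_div_assoc', mul_div_assoc', ← mul_assoc, ← mul_assoc, e,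
      show c + ((n + 1 : ℕ) : ℂ) = c + 1 + n by push_cast; ring, inv_Gamma_eq (c + 1 + n),
      show c + 1 + ((n + 1 : ℕ) : ℂ) = c + 1 + n + 1 by push_cast; ring, Nat.factorial_succ,
      pow_succ, poch_succ_left a, poch_succ_left b, poch_succ (a + 1), poch_succ (b + 1)]
    generalize (Gamma (c + 1 + n + 1))⁻¹ = G
    rw [hc]
    push_cast
    field_simp
    ring

theorem gaussHalf_add_two_add_two (a b : ℂ) :
    gaussHalf a b ((a + b + 1) / 2) =
      (a + 1) / 2 * ((b + 1) / 2) * gaussHalf (a + 2) (b + 2) ((a + b + 1) / 2 + 2) := by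
  have h := gaussHalf_add_two b (a + 2)
  rw [show (b + (a + 2) + 1) / 2 = (a + b + 1) / 2 + 1 by ring,
    show (a + b + 1) / 2 + 1 + 1 = (a + b + 1) / 2 + 2 by ring, gaussHalf_swap b,
    gaussHalf_swap (b + 2)] at h
  rw [← gaussHalf_add_two, ← h]
  ring

theorem gaussHalf_eq_poch_mul (a b : ℂ) (k : ℕ) :
    gaussHalf a b ((a + b + 1) / 2) = poch ((a + 1) / 2) k * poch ((b + 1) / 2) k *
      gaussHalf (a + (2 * k : ℕ)) (b + (2 * k : ℕ)) ((a + b + 1) / 2 + (2 * k : ℕ)) := by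
  induction k with
  | zero => simp [poch_zero]
  | succ k ih =>
    have h := gaussHalf_add_two_add_two (a + (2 * k : ℕ)) (b + (2 * k : ℕ))
    rw [show (a + (2 * k : ℕ) + (b + (2 * k : ℕ)) + 1) / 2 = (a + b + 1) / 2 + (2 * k : ℕ) by ring]
      at h
    rw [ih, h, poch_succ, poch_succ]
    push_cast
    ring_nf

theorem tendsto_Gamma_ratio {p q r s : ℂ} (h : p + q = r + s) :
    Filter.Tendsto (fun n : ℕ => Gamma (p + n) * Gamma (q + n) / (Gamma (r + n) * Gamma (s + n)))
      Filter.atTop (nhds 1) := by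
  have main {p q r s : ℂ} (hp : notNonposInt p) (hq : notNonposInt q) (hr : notNonposInt r)
      (hs : notNonposInt s) (h : p + q = r + s) :
      Filter.Tendsto (fun n : ℕ => Gamma (p + (n + 1 : ℕ)) * Gamma (q + (n + 1 : ℕ)) /
        (Gamma (r + (n + 1 : ℕ)) * Gamma (s + (n + 1 : ℕ)))) Filter.atTop (nhds 1) := by
    have hp' := Gamma_ne_zero hp
    have hq' := Gamma_ne_zero hq
    have hr' := Gamma_ne_zero hr
    have hs' := Gamma_ne_zero hs
    have H := (((GammaSeq_tendsto_Gamma r).div tendsto_const_nhds hr').mul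
      ((GammaSeq_tendsto_Gamma s).div tendsto_const_nhds hs')).div
      (((GammaSeq_tendsto_Gamma p).div tendsto_const_nhds hp').mul
      ((GammaSeq_tendsto_Gamma q).div tendsto_const_nhds hq')) (by simp [hp', hq'])
    rw [div_self hp', div_self hq', div_self hr', div_self hs', mul_one, div_one] at H
    refine H.congr' ?_
    filter_upwards [Filter.eventually_ne_atTop 0] with n hn
    have hn' : (n : ℂ) ≠ 0 := Nat.cast_ne_zero.mpr hn
    have hf : (n.factorial : ℂ) ≠ 0 := Nat.cast_ne_zero.mpr n.factorial_ne_zero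
    have hpow : (n : ℂ) ^ p * (n : ℂ) ^ q = (n : ℂ) ^ r * (n : ℂ) ^ s := by
      rw [← cpow_add _ _ hn', ← cpow_add _ _ hn', h]
    have hG (z : ℂ) : GammaSeq z n = (n : ℂ) ^ z * n.factorial / poch z (n + 1) := rfl
    have c1 (z : ℂ) : (n : ℂ) ^ z ≠ 0 := by simp [cpow_eq_zero_iff, hn]
    have hpn := poch_ne_zero hp (n + 1)
    have hqn := poch_ne_zero hq (n + 1)
    have hrn := poch_ne_zero hr (n + 1)
    have hsn := poch_ne_zero hs (n + 1)
    simp only [Pi.div_apply, hG]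
    rw [Gamma_add_natCast hp, Gamma_add_natCast hq, Gamma_add_natCast hr, Gamma_add_natCast hs]
    have := c1 p
    have := c1 q
    field_simp
    linear_combination -hpow
  have hev := (((eventually_notNonposInt p).and (eventually_notNonposInt q)).and
    ((eventually_notNonposInt r).and (eventually_notNonposInt s))).exists
  obtain ⟨M, ⟨hp, hq⟩, hr, hs⟩ := hev
  rw [← Filter.tendsto_add_atTop_iff_nat (M + 1)]
  refine (main hp hq hr hs (by linear_combination h)).congr fun n => ?_
  push_cast
  ring_nf

theorem poch_eq_eval (s : ℂ) (n : ℕ) : poch s n = (ascPochhammer ℂ n).eval s := by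
  induction n with
  | zero => simp [poch_zero]
  | succ n ih => rw [poch_succ, ascPochhammer_succ_eval, ih]

theorem hasSum_poch_half (s : ℂ) :
    HasSum (fun n : ℕ => poch s n / n.factorial / 2 ^ n) (2 ^ s) := by
  have h := (one_div_one_sub_cpow_hasFPowerSeriesOnBall_zero s).hasSum (y := 1 / 2) (by
    rw [Metric.mem_eball, edist_zero_right, ← ofReal_norm]
    norm_num)
  have e : (1 : ℂ) / (1 - (0 + 1 / 2)) ^ s = 2 ^ s := by
    rw [zero_add, show (1 : ℂ) - 1 / 2 = 2⁻¹ by norm_num, inv_cpow _ _ (by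
      rw [ofNat_arg]
      exact Real.pi_ne_zero.symm), one_div, inv_inv]
  rw [e] at h
  refine h.congr_fun fun n => ?_
  have h1 : (n.factorial : ℂ) * Ring.choose (s + n - 1) n = poch s n := by
    rw [poch_eq_eval, ← Polynomial.ascPochhammer_smeval_eq_eval,
      ← Ring.factorial_nsmul_multichoose_eq_ascPochhammer, nsmul_eq_mul, Ring.choose,
      show s + n - 1 - n + 1 = s by ring]
  have hf : (n.factorial : ℂ) ≠ 0 := Nat.cast_ne_zero.mpr n.factorial_ne_zero
  rw [← h1]
  simp [FormalMultilinearSeries.ofScalars]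
  field_simp

theorem norm_poch_le (s : ℂ) (m n : ℕ) :
    ‖poch (s + m) n‖ ≤ ∏ k ∈ Finset.range n, (‖s‖ + m + k) := by
  rw [poch, norm_prod]
  gcongr with k
  refine (norm_add_le _ _).trans ?_
  rw [norm_natCast]
  gcongr
  refine (norm_add_le _ _).trans ?_
  rw [norm_natCast]

theorem hasSum_prod_half (r : ℝ) :
    HasSum (fun n : ℕ => (∏ k ∈ Finset.range n, (r + k)) / n.factorial / 2 ^ n) ((2 : ℝ) ^ r) := by
  rw [← hasSum_ofReal]
  have h := hasSum_poch_half r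
  rw [← ofReal_ofNat, ← ofReal_cpow two_pos.le] at h
  refine h.congr_fun fun n => ?_
  rw [poch]
  push_cast
  rfl

theorem tendsto_gaussHalf_add_natCast (a b c : ℂ) :
    Filter.Tendsto (fun m : ℕ => gaussHalf (a + m) (b + m) (c + m) * Gamma (c + m) /
      2 ^ (a + b - c + m)) Filter.atTop (nhds 1) := by
  set s := a + b - c with hs
  set ρ : ℕ → ℂ := fun n => Gamma (a + n) * Gamma (b + n) / (Gamma (c + n) * Gamma (s + n)) with hρ
  have hρ1 : Filter.Tendsto ρ Filter.atTop (nhds 1) := tendsto_Gamma_ratio (by rw [hs]; ring)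
  have hpole := ((eventually_notNonposInt a).and (eventually_notNonposInt b)).and
    ((eventually_notNonposInt c).and (eventually_notNonposInt s))
  have hY : Filter.Tendsto (fun m : ℕ => gaussHalf (a + m) (b + m) (c + m) * Gamma (c + m) /
      2 ^ (s + m) * ρ m) Filter.atTop (nhds 1) := by
    rw [Metric.tendsto_atTop]
    intro ε hε
    set C : ℝ := 2 ^ (‖s‖ - s.re) with hC
    have hC0 : 0 < C := by positivity
    obtain ⟨K, hK⟩ := Metric.tendsto_atTop.mp hρ1 (ε / 2 / C) (by positivity)
    obtain ⟨L, hL⟩ := Filter.eventually_atTop.mp hpole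
    refine ⟨max K L, fun m hm => ?_⟩
    obtain ⟨⟨ha, hb⟩, hc, hs'⟩ := hL m (le_of_max_le_right hm)
    have hterm (n : ℕ) : gaussTerm (a + m) (b + m) (c + m) n * (Gamma (c + m) * ρ m) -
        poch (s + m) n / n.factorial / 2 ^ n =
        (ρ (m + n) - 1) * (poch (s + m) n / n.factorial / 2 ^ n) := by
      have := Gamma_ne_zero hc
      have := Gamma_ne_zero hs'
      have := Gamma_ne_zero ha
      have := Gamma_ne_zero hb
      have := poch_ne_zero hc n
      have := poch_ne_zero hs' n
      have hf : (n.factorial : ℂ) ≠ 0 := Nat.cast_ne_zero.mpr n.factorial_ne_zero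
      simp only [hρ, gaussTerm, Nat.cast_add, ← add_assoc]
      rw [Gamma_add_natCast ha, Gamma_add_natCast hb, Gamma_add_natCast hc, Gamma_add_natCast hs']
      field_simp
    have h1 := ((summable_gaussTerm (a + m) (b + m) (c + m)).hasSum.mul_right
      (Gamma (c + m) * ρ m)).sub (hasSum_poch_half (s + m))
    have h2 := (hasSum_prod_half (‖s‖ + m)).mul_left (ε / 2 / C)
    have h3 := h1.norm_le_of_bounded h2 fun n => by
      rw [hterm, norm_mul, norm_div, norm_div, norm_natCast, norm_pow, norm_ofNat]
      gcongr
      · rw [← dist_eq_norm]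
        exact (hK _ (by have := le_of_max_le_left hm; omega)).le
      · exact norm_poch_le s m n
    have h20 : (2 : ℂ) ^ (s + m) ≠ 0 := by simp [cpow_eq_zero_iff]
    have e : gaussHalf (a + m) (b + m) (c + m) * Gamma (c + m) / 2 ^ (s + m) * ρ m - 1 =
        ((∑' n, gaussTerm (a + m) (b + m) (c + m) n) * (Gamma (c + m) * ρ m) - 2 ^ (s + m)) /
          2 ^ (s + m) := by
      rw [gaussHalf]
      field_simp
    have hn : ‖(2 : ℂ) ^ (s + m)‖ = 2 ^ (s.re + m) := by
      rw [← ofReal_ofNat, norm_cpow_eq_rpow_re_of_pos two_pos]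
      simp
    rw [dist_eq_norm, e, norm_div, hn, div_lt_iff₀ (by positivity)]
    refine h3.trans_lt ?_
    have hexp : (2 : ℝ) ^ (‖s‖ + m) = C * 2 ^ (s.re + m) := by
      rw [hC, ← Real.rpow_add two_pos]
      ring_nf
    rw [hexp, ← mul_assoc, div_mul_cancel₀ _ hC0.ne']
    have : (0 : ℝ) < 2 ^ (s.re + m) := by positivity
    gcongr
    linarith
  have h := hY.div hρ1 one_ne_zero
  rw [div_one] at h
  refine h.congr' ?_
  filter_upwards [hpole] with m hm
  have := Gamma_ne_zero hm.1.1
  have := Gamma_ne_zero hm.1.2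
  have := Gamma_ne_zero hm.2.1
  have := Gamma_ne_zero hm.2.2
  have : ρ m ≠ 0 := div_ne_zero (mul_ne_zero ‹_› ‹_›) (mul_ne_zero ‹_› ‹_›)
  simp only [Pi.div_apply]
  field_simp

theorem eventually_poch_eq (z : ℂ) :
    ∀ᶠ k : ℕ in Filter.atTop, poch z k = (Gamma z)⁻¹ * Gamma (z + k) := by
  by_cases hz : notNonposInt z
  · refine Filter.Eventually.of_forall fun k => ?_
    have := Gamma_ne_zero hz
    rw [Gamma_add_natCast hz]
    field_simp
  · simp only [notNonposInt, not_forall, not_not] at hz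
    obtain ⟨m, rfl⟩ := hz
    filter_upwards [Filter.eventually_gt_atTop m] with k hk
    rw [Gamma_neg_nat_eq_zero, inv_zero, zero_mul]
    exact Finset.prod_eq_zero (Finset.mem_range.mpr hk) (by simp)

/-- **Gauss's second summation theorem**, in regularized form. -/
theorem gaussHalf_eq (a b : ℂ) :
    gaussHalf a b ((a + b + 1) / 2) =
      (√Real.pi : ℝ) * (Gamma ((a + 1) / 2))⁻¹ * (Gamma ((b + 1) / 2))⁻¹ := by
  set c := (a + b + 1) / 2 with hc
  have hX : Filter.Tendsto (fun k : ℕ => gaussHalf (a + (2 * k : ℕ)) (b + (2 * k : ℕ))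
      (c + (2 * k : ℕ)) * Gamma (c + (2 * k : ℕ)) / 2 ^ (a + b - c + (2 * k : ℕ)))
      Filter.atTop (nhds 1) :=
    (tendsto_gaussHalf_add_natCast a b c).comp
      (Filter.tendsto_id.const_mul_atTop' two_pos)
  have hR := tendsto_Gamma_ratio (p := (a + 1) / 2) (q := (b + 1) / 2) (r := c / 2)
    (s := c / 2 + 1 / 2) (by rw [hc]; ring)
  have h := (hX.mul hR).const_mul
    ((√Real.pi : ℝ) * (Gamma ((a + 1) / 2))⁻¹ * (Gamma ((b + 1) / 2))⁻¹)
  rw [mul_one, mul_one] at h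
  refine tendsto_nhds_unique (tendsto_const_nhds.congr' ?_) h
  filter_upwards [eventually_poch_eq ((a + 1) / 2), eventually_poch_eq ((b + 1) / 2),
    eventually_notNonposInt (c / 2), eventually_notNonposInt (c / 2 + 1 / 2)] with k h1 h2 h3 h4
  rw [gaussHalf_eq_poch_mul a b k, h1, h2, ← hc]
  have hd := Gamma_mul_Gamma_add_half (c / 2 + k)
  rw [show 2 * (c / 2 + k) = c + (2 * k : ℕ) by push_cast; ring,
    show c / 2 + k + 1 / 2 = c / 2 + 1 / 2 + k by ring] at hd
  have hp : (2 : ℂ) ^ (1 - (c + (2 * k : ℕ))) * 2 ^ (a + b - c + (2 * k : ℕ)) = 1 := by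
    rw [← cpow_add _ _ two_ne_zero, show 1 - (c + (2 * k : ℕ)) + (a + b - c + (2 * k : ℕ)) = 0 by
      rw [hc]; ring, cpow_zero]
  have := Gamma_ne_zero h3
  have := Gamma_ne_zero h4
  have h20 : (2 : ℂ) ^ (a + b - c + (2 * k : ℕ)) ≠ 0 := by simp [cpow_eq_zero_iff]
  have hd' : Gamma (c + (2 * k : ℕ)) * (√Real.pi : ℝ) / 2 ^ (a + b - c + (2 * k : ℕ)) =
      Gamma (c / 2 + k) * Gamma (c / 2 + 1 / 2 + k) := by
    rw [hd, div_eq_iff h20]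
    linear_combination (-Gamma (c + (2 * k : ℕ)) * (√Real.pi : ℝ)) * hp
  generalize gaussHalf (a + (2 * k : ℕ)) (b + (2 * k : ℕ)) (c + (2 * k : ℕ)) = E at *
  calc _ = (Gamma ((a + 1) / 2))⁻¹ * (Gamma ((b + 1) / 2))⁻¹ * E * (Gamma ((a + 1) / 2 + k) *
        Gamma ((b + 1) / 2 + k)) := by ring
    _ = (Gamma ((a + 1) / 2))⁻¹ * (Gamma ((b + 1) / 2))⁻¹ * E *
        (Gamma (c + (2 * k : ℕ)) * (√Real.pi : ℝ) / 2 ^ (a + b - c + (2 * k : ℕ))) *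
        (Gamma ((a + 1) / 2 + k) * Gamma ((b + 1) / 2 + k) /
          (Gamma (c / 2 + k) * Gamma (c / 2 + 1 / 2 + k))) := by
      rw [hd']
      generalize Gamma (c / 2 + k) = X, Gamma (c / 2 + 1 / 2 + k) = Y at *
      field_simp
    _ = _ := by ring

theorem sum_alternating_choose_succ (f : ℕ → ℂ) (i : ℕ) :
    ∑ r ∈ Finset.range (i + 1 + 1), (-1) ^ r * ((i + 1).choose r : ℂ) * f r =
      ∑ r ∈ Finset.range (i + 1), (-1) ^ r * (i.choose r : ℂ) * f r -
        ∑ r ∈ Finset.range (i + 1), (-1) ^ r * (i.choose r : ℂ) * f (r + 1) := by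
  have h : ∑ r ∈ Finset.range (i + 1), (-1) ^ r * (i.choose r : ℂ) * f r =
      ∑ r ∈ Finset.range (i + 1 + 1), (-1) ^ r * (i.choose r : ℂ) * f r := by
    rw [Finset.sum_range_succ _ (i + 1), Nat.choose_succ_self]
    simp
  rw [h, Finset.sum_range_succ', Finset.sum_range_succ' _ (i + 1), add_sub_right_comm,
    ← Finset.sum_sub_distrib, Nat.choose_zero_right, Nat.choose_zero_right]
  congr 1
  refine Finset.sum_congr rfl fun r _ => ?_
  rw [Nat.choose_succ_succ]
  push_cast
  ring

/-- Generalization of Gauss's second summation theorem to contiguous parameters. -/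
theorem gaussHalf_contiguous_eq (i : ℕ) {a b : ℂ} (ha : notNonposInt a)
    (hab : notNonposInt ((b - a + 1 - i) / 2)) :
    gaussHalf a b ((a + b + 1 + i) / 2) =
      2 ^ (a - 1) * Gamma ((b - a + 1 - i) / 2) / (Gamma ((b - a + 1 + i) / 2) * Gamma a) *
        ∑ r ∈ Finset.range (i + 1), (-1) ^ r * (i.choose r : ℂ) * Gamma ((a + r) / 2) /
          Gamma ((b + r + 1 - i) / 2) := by
  induction i generalizing a b with
  | zero =>
    have h1 := Gamma_ne_zero ha
    simp only [Nat.cast_zero, add_zero, sub_zero] at hab ⊢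
    have h2 := Gamma_ne_zero hab
    rw [gaussHalf_eq]
    have h3 : Gamma ((a + 1) / 2) ≠ 0 := Gamma_ne_zero fun m h => ha (2 * m + 1) <| by
      push_cast
      linear_combination 2 * h
    have hd := Gamma_mul_Gamma_add_half (a / 2)
    rw [show 2 * (a / 2) = a by ring, show a / 2 + 1 / 2 = (a + 1) / 2 by ring] at hd
    have hp : (2 : ℂ) ^ (1 - a) * 2 ^ (a - 1) = 1 := by
      rw [← cpow_add _ _ two_ne_zero, show 1 - a + (a - 1) = 0 by ring, cpow_zero]
    have hd' : (√Real.pi : ℝ) * (Gamma ((a + 1) / 2))⁻¹ =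
        2 ^ (a - 1) * Gamma (a / 2) / Gamma a := by
      rw [← div_eq_mul_inv, div_eq_div_iff h3 h1]
      linear_combination (-2 ^ (a - 1)) * hd - Gamma a * (√Real.pi : ℝ) * hp
    rw [hd']
    simp only [zero_add, Finset.sum_range_one, pow_zero, Nat.choose_self, Nat.cast_one, one_mul,
      Nat.cast_zero, add_zero]
    field_simp
  | succ i ih =>
    have hab' : notNonposInt ((b - a - i) / 2) := by
      convert hab using 2
      push_cast
      ring
    have h1 := ih (a := a) (b := b - 1) ha (by convert hab' using 2; ring)
    have h2 := ih (a := a + 1) (b := b)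
      (by simpa using ha.add_natCast 1) (by convert hab' using 2; ring)
    have hc := gaussHalf_contiguous a b ((a + b + 1 + (i + 1 : ℕ)) / 2)
    have hz : notNonposInt ((b - a + i) / 2) := by
      convert hab'.add_natCast i using 1
      ring
    have hz0 : (b - a + i) / 2 ≠ 0 := fun h => hz 0 (by simpa using h)
    have ha0 : a ≠ 0 := fun h => ha 0 (by simpa using h)
    rw [show (a + b + 1 + (i + 1 : ℕ)) / 2 - 1 = (a + (b - 1) + 1 + i) / 2 by push_cast; ring, h1,
      show (a + b + 1 + (i + 1 : ℕ)) / 2 = (a + 1 + b + 1 + i) / 2 by push_cast; ring, h2,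
      show (a + (b - 1) + 1 + i) / 2 - a = (b - a + i) / 2 by ring,
      show b - 1 - a + 1 - i = b - a - i by ring, show b - 1 - a + 1 + i = b - a + i by ring,
      show b - (a + 1) + 1 - i = b - a - i by ring, show b - (a + 1) + 1 + i = b - a + i by ring,
      add_sub_cancel_right, Gamma_add_one a ha0] at hc
    have hpow : (2 : ℂ) ^ a = 2 ^ (a - 1) * 2 := by
      rw [cpow_sub _ _ two_ne_zero, cpow_one]
      ring
    rw [show (a + b + 1 + (i + 1 : ℕ)) / 2 = (a + 1 + b + 1 + i) / 2 by push_cast; ring,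
      ← mul_right_inj' hz0, hc, hpow,
      show (b - a + 1 - (i + 1 : ℕ)) / 2 = (b - a - i) / 2 by push_cast; ring,
      show (b - a + 1 + (i + 1 : ℕ)) / 2 = (b - a + i) / 2 + 1 by push_cast; ring,
      Gamma_add_one _ hz0]
    have hsum := sum_alternating_choose_succ
      (fun r => Gamma ((a + r) / 2) / Gamma ((b + r - i) / 2)) i
    have e0 : ∑ r ∈ Finset.range (i + 1 + 1), (-1) ^ r * ((i + 1).choose r : ℂ) *
        Gamma ((a + r) / 2) / Gamma ((b + r + 1 - (i + 1 : ℕ)) / 2) =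
        ∑ r ∈ Finset.range (i + 1 + 1), (-1) ^ r * ((i + 1).choose r : ℂ) *
        (Gamma ((a + r) / 2) / Gamma ((b + r - i) / 2)) :=
      Finset.sum_congr rfl fun r _ => by push_cast; ring_nf
    have e1 : ∑ r ∈ Finset.range (i + 1), (-1) ^ r * (i.choose r : ℂ) *
        Gamma ((a + r) / 2) / Gamma ((b - 1 + r + 1 - i) / 2) =
        ∑ r ∈ Finset.range (i + 1), (-1) ^ r * (i.choose r : ℂ) *
        (Gamma ((a + r) / 2) / Gamma ((b + r - i) / 2)) :=
      Finset.sum_congr rfl fun r _ => by ring_nf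
    have e2 : ∑ r ∈ Finset.range (i + 1), (-1) ^ r * (i.choose r : ℂ) *
        Gamma ((a + 1 + r) / 2) / Gamma ((b + r + 1 - i) / 2) =
        ∑ r ∈ Finset.range (i + 1), (-1) ^ r * (i.choose r : ℂ) *
        (Gamma ((a + (r + 1 : ℕ)) / 2) / Gamma ((b + (r + 1 : ℕ) - i) / 2)) :=
      Finset.sum_congr rfl fun r _ => by push_cast; ring_nf
    rw [e0, e1, e2, hsum]
    have := Gamma_ne_zero hz
    have := Gamma_ne_zero ha
    generalize (b - a + i) / 2 = z at *
    field_simp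

theorem kdfTerm_mul_eq {β γ q : ℂ} (hβ : ∀ n, poch β n ≠ 0)
    (hd : ∀ n, poch (γ - 1 - β / 2) n ≠ 0) (hγ : ∀ n, poch γ n ≠ 0) {N n : ℕ} (hn : n ≤ N) :
    kdfTerm (2 * (γ - 1 - β / 2)) (β - (γ - q)) (γ - q) (γ - 1 - β / 2 + 1) (γ - 1 - β) β
        (γ - 1 - β / 2) γ (1 / 2) (1 / 2) (N - n, n) *
      (2 * (γ - 1 - β / 2) * poch β N * poch γ N * N.factorial * 2 ^ N) =
    poch (2 * (γ - 1 - β / 2)) N * ((N.choose n : ℂ) * poch (γ - q) n * poch (γ - 1 - β) n *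
      (2 * (γ - 1 - β / 2 + n)) * poch (γ + n) (N - n) * poch (β - (γ - q)) (N - n)) := by
  obtain ⟨m, rfl⟩ := Nat.exists_eq_add_of_le' hn
  have hc : (((m + n).choose n : ℕ) : ℂ) * m.factorial * n.factorial = (m + n).factorial := by
    have := Nat.add_choose_mul_factorial_mul_factorial m n
    exact_mod_cast this
  have hp := poch_add γ n m
  have hm := poch_mul_add (γ - 1 - β / 2) n
  have h1 := hβ (m + n)
  have h2 := hd n
  have h3 := hγ n
  have hf1 : (m.factorial : ℂ) ≠ 0 := by exact_mod_cast m.factorial_ne_zero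
  have hf2 : (n.factorial : ℂ) ≠ 0 := by exact_mod_cast n.factorial_ne_zero
  rw [add_comm n m] at hp
  simp only [kdfTerm, Nat.add_sub_cancel]
  rw [hp, ← hc, pow_add, one_div, inv_pow, inv_pow]
  generalize γ - 1 - β / 2 = δ at *
  generalize poch (2 * δ) (m + n) = P at *
  generalize poch δ n = D at *
  generalize poch (δ + 1) n = D' at *
  field_simp
  linear_combination -(P * poch (β - (γ - q)) m * poch (γ - q) n * poch (γ - 1 - β) n *
    poch (γ + n) m * ((m + n).choose n : ℂ)) * hm

theorem sum_antidiagonal_kdfTerm {β γ q : ℂ} (hβ : ∀ n, poch β n ≠ 0)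
    (hd : ∀ n, poch (γ - 1 - β / 2) n ≠ 0) (hγ : ∀ n, poch γ n ≠ 0) (N : ℕ) :
    (∑ p ∈ Finset.HasAntidiagonal.antidiagonal N, kdfTerm (2 * (γ - 1 - β / 2)) (β - (γ - q)) (γ - q)
        (γ - 1 - β / 2 + 1) (γ - 1 - β) β (γ - 1 - β / 2) γ (1 / 2) (1 / 2) p) *
      (2 * (γ - 1 - β / 2) * poch γ N * N.factorial * 2 ^ N) =
    poch (2 * (γ - 1 - β / 2)) N *
      ((γ - 1 - β) * poch q N + (γ - 1 + N) * poch (q - 1) N) := by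
  rw [← Finset.Nat.sum_antidiagonal_swap, Finset.Nat.sum_antidiagonal_eq_sum_range_succ_mk]
  refine mul_right_cancel₀ (hβ N) ?_
  have h := sum_kdf_coeff β γ q N
  rw [mul_assoc, mul_assoc (poch _ N), mul_comm (_ + _) (poch β N), ← h, Finset.mul_sum,
    Finset.sum_mul]
  refine Finset.sum_congr rfl fun n hn => ?_
  rw [← kdfTerm_mul_eq hβ hd hγ (Finset.mem_range_succ_iff.mp hn)]
  simp only [Prod.swap]
  ring

theorem tsum_kdfTerm_eq {β γ q : ℂ} (hβ : ∀ n, poch β n ≠ 0)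
    (hd : ∀ n, poch (γ - 1 - β / 2) n ≠ 0) (hγ : notNonposInt γ)
    (hs : Summable (kdfTerm (2 * (γ - 1 - β / 2)) (β - (γ - q)) (γ - q) (γ - 1 - β / 2 + 1)
      (γ - 1 - β) β (γ - 1 - β / 2) γ (1 / 2) (1 / 2))) :
    ∑' p, kdfTerm (2 * (γ - 1 - β / 2)) (β - (γ - q)) (γ - q) (γ - 1 - β / 2 + 1)
        (γ - 1 - β) β (γ - 1 - β / 2) γ (1 / 2) (1 / 2) p =
      Gamma γ / 2 * gaussHalf (2 * (γ - 1 - β / 2) + 1) q γ := by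
  have hG : Gamma γ ≠ 0 := Gamma_ne_zero hγ
  have hα : γ - 1 - β / 2 ≠ 0 := by simpa [poch] using hd 1
  have hγn := poch_ne_zero hγ
  have hv : ∀ n, gaussTerm (2 * (γ - 1 - β / 2) + 1) q γ n * Gamma γ *
      (poch γ n * n.factorial * 2 ^ n) = poch (2 * (γ - 1 - β / 2) + 1) n * poch q n := by
    intro n
    have hn : (n.factorial : ℂ) ≠ 0 := by exact_mod_cast n.factorial_ne_zero
    have := hγn n
    rw [gaussTerm, Gamma_add_natCast hγ]
    field_simp
  have hg := summable_gaussTerm (2 * (γ - 1 - β / 2) + 1) q γ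
  rw [← Finset.HasAntidiagonal.sigmaAntidiagonalEquivProd.tsum_eq]
  have hs' := (Finset.HasAntidiagonal.sigmaAntidiagonalEquivProd
    (A := ℕ)).summable_iff.mpr hs
  change ∑' c, (kdfTerm _ _ _ _ _ _ _ _ _ _ ∘ _) c = _
  rw [Summable.tsum_sigma' (fun n => (hasSum_fintype _).summable) hs']
  have hS := hs'.sigma
  simp only [Function.comp_apply, tsum_fintype,
    Finset.HasAntidiagonal.sigmaAntidiagonalEquivProd_apply] at hS ⊢
  rw [gaussHalf, ← tsum_mul_left]
  refine tsum_eq_of_telescope hS (hg.mul_left _) (hg.mul_left (-(Gamma γ / 2))) ?_ fun n => ?_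
  · rw [Finset.sum_coe_sort (Finset.HasAntidiagonal.antidiagonal 0)]
    have h := sum_antidiagonal_kdfTerm (q := q) hβ hd hγn 0
    have h0 := hv 0
    simp only [poch_zero, Nat.factorial_zero, Nat.cast_one, Nat.cast_zero, pow_zero, mul_one,
      add_zero] at h h0
    refine mul_right_cancel₀ hα ?_
    linear_combination h / 2 - (γ - 1 - β / 2) * h0
  · rw [Finset.sum_coe_sort (Finset.HasAntidiagonal.antidiagonal (n + 1))]
    have h := sum_antidiagonal_kdfTerm (q := q) hβ hd hγn (n + 1)
    have h0 := hv n
    have h1 := hv (n + 1)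
    have hf : ((n + 1).factorial : ℂ) ≠ 0 := by exact_mod_cast (n + 1).factorial_ne_zero
    refine mul_right_cancel₀ (mul_ne_zero (mul_ne_zero (mul_ne_zero (mul_ne_zero two_ne_zero hα)
      (hγn (n + 1))) hf) (pow_ne_zero (n + 1) two_ne_zero)) (h.trans ?_)
    rw [poch_succ_left (q - 1), sub_add_cancel, poch_succ_left (2 * (γ - 1 - β / 2))]
    rw [poch_succ] at h1
    simp only [poch_succ q, poch_succ γ, Nat.factorial_succ] at h1 ⊢
    push_cast at h1 ⊢
    rw [poch_succ] at h1
    generalize gaussTerm (2 * (γ - 1 - β / 2) + 1) q γ (n + 1) = v1 at *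
    generalize gaussTerm (2 * (γ - 1 - β / 2) + 1) q γ n = v0 at *
    linear_combination (-(2 * (γ - 1 - β / 2))) * h1 +
      (2 * (γ - 1 - β / 2)) * (γ + n) * (n + 1) * h0

theorem stmt_10 (i : ℕ) (α β : ℂ)
    (hβ : ∀ m n : ℕ, poch β (m + n) ≠ 0)
    (hd1 : ∀ n : ℕ, poch (α / 2) n ≠ 0)
    (hd2 : ∀ n : ℕ, poch (1 + (α + β) / 2) n ≠ 0)
    (hΓ1 : notNonposInt (β / 2 - α / 2 - (i : ℂ)))
    (hΓ2 : notNonposInt (1 + (α + β) / 2))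
    (hΓ3 : notNonposInt (β / 2 - α / 2))
    (hΓ4 : notNonposInt (1 + α))
    (hΓs : ∀ r : ℕ, r ≤ i →
      notNonposInt ((α + (r : ℂ) + 1) / 2) ∧ notNonposInt ((β + (r : ℂ) + 1) / 2 - (i : ℂ)))
    (hsum : Summable fun p : ℕ × ℕ => ‖kdfTerm α (3 * β / 2 - α / 2 - 1 - (i : ℂ)) ((α - β) / 2 + 1 + (i : ℂ)) (1 + α / 2) ((α - β) / 2) β (α / 2) (1 + (α + β) / 2) (1/2) (1/2) p‖) :
    (∑' p : ℕ × ℕ, kdfTerm α (3 * β / 2 - α / 2 - 1 - (i : ℂ)) ((α - β) / 2 + 1 + (i : ℂ)) (1 + α / 2) ((α - β) / 2) β (α / 2) (1 + (α + β) / 2) (1/2) (1/2) p) =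
      (2 : ℂ) ^ (α - 1) * Gamma (β / 2 - α / 2 - (i : ℂ)) * Gamma (1 + (α + β) / 2) /
        (Gamma (β / 2 - α / 2) * Gamma (1 + α)) *
      ∑ r ∈ Finset.range (i + 1), (-1 : ℂ) ^ r * (i.choose r : ℂ) *
        Gamma ((α + (r : ℂ) + 1) / 2) /
        Gamma ((β + (r : ℂ) + 1) / 2 - (i : ℂ)) := by
  have e1 : α = 2 * (1 + (α + β) / 2 - 1 - β / 2) := by ring
  have e2 : 3 * β / 2 - α / 2 - 1 - (i : ℂ) = β - (1 + (α + β) / 2 - (β - i)) := by ring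
  have e3 : (α - β) / 2 + 1 + (i : ℂ) = 1 + (α + β) / 2 - (β - i) := by ring
  have e4 : 1 + α / 2 = 1 + (α + β) / 2 - 1 - β / 2 + 1 := by ring
  have e5 : (α - β) / 2 = 1 + (α + β) / 2 - 1 - β := by ring
  have e6 : α / 2 = 1 + (α + β) / 2 - 1 - β / 2 := by ring
  have key : kdfTerm α (3 * β / 2 - α / 2 - 1 - (i : ℂ)) ((α - β) / 2 + 1 + (i : ℂ)) (1 + α / 2)
      ((α - β) / 2) β (α / 2) (1 + (α + β) / 2) (1/2) (1/2) =
      kdfTerm (2 * (1 + (α + β) / 2 - 1 - β / 2)) (β - (1 + (α + β) / 2 - (β - i)))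
        (1 + (α + β) / 2 - (β - i)) (1 + (α + β) / 2 - 1 - β / 2 + 1)
        (1 + (α + β) / 2 - 1 - β) β (1 + (α + β) / 2 - 1 - β / 2) (1 + (α + β) / 2)
        (1 / 2) (1 / 2) := by
    rw [← e1, ← e2, ← e3, ← e4, ← e5, ← e6]
  have hs := hsum.of_norm
  rw [key] at hs ⊢
  rw [tsum_kdfTerm_eq (fun n => by simpa using hβ 0 n) (fun n => e6 ▸ hd1 n) hΓ2 hs, ← e1]
  have e7 : 1 + (α + β) / 2 = (α + 1 + (β - i) + 1 + i) / 2 := by ring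
  have e8 : (β - i - (α + 1) + 1 - i) / 2 = β / 2 - α / 2 - i := by ring
  have e9 : (β - i - (α + 1) + 1 + i) / 2 = β / 2 - α / 2 := by ring
  have h := gaussHalf_contiguous_eq i (a := α + 1) (b := β - i) (by rwa [add_comm])
    (by rwa [e8])
  rw [← e7, e8, e9, add_sub_cancel_right] at h
  have hsumeq : ∀ r : ℕ, (-1 : ℂ) ^ r * (i.choose r : ℂ) * Gamma ((α + 1 + r) / 2) /
      Gamma ((β - i + r + 1 - i) / 2) = (-1 : ℂ) ^ r * (i.choose r : ℂ) *
        Gamma ((α + r + 1) / 2) / Gamma ((β + r + 1) / 2 - i) := fun r => by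
    rw [show α + 1 + r = α + r + 1 by ring,
      show (β - i + r + 1 - i) / 2 = (β + r + 1) / 2 - i by ring]
  simp_rw [hsumeq] at h
  rw [h, cpow_sub _ _ two_ne_zero, cpow_one, add_comm α 1]
  ring
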